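/- Let z(x) = 27x²(1−x)/(1−3x)³ and h(x) = (1−3x)^{−1} · ₂F₁(1/3, 2/3; 1; z(x)). Then for all x ∈ (0, 1/9) one has 0 < z(x) < 1 and x(1−x)(1−9x)·h''(x) + (1 − 20x + 27x²)·h'(x) + (9x − 3)·h(x) = 0; moreover h extends continuously to x = 0 with h(0) = 1 and h'(0) = 3. -/

import Mathlib

/-- The Gauss hypergeometric series `₂F₁(a,b;c;z) = ∑ (a)ₙ(b)ₙ/((c)ₙ n!) zⁿ`. -/
noncomputable def hyp2F1 (a b c z : ℝ) : ℝ :=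
  ∑' n : ℕ, ((ascPochhammer ℝ n).eval a * (ascPochhammer ℝ n).eval b) /
    ((ascPochhammer ℝ n).eval c * (n.factorial : ℝ)) * z ^ n

/-- `z(x) = 27x²(1−x)/(1−3x)³`. -/
noncomputable def zFun (x : ℝ) : ℝ := 27 * x ^ 2 * (1 - x) / (1 - 3 * x) ^ 3

/-- `h(x) = (1−3x)⁻¹ ₂F₁(1/3,2/3;1;z(x))`. -/
noncomputable def hFun (x : ℝ) : ℝ := (1 - 3 * x)⁻¹ * hyp2F1 (1 / 3) (2 / 3) 1 (zFun x)

open Filter Topology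

lemma summable_mul_pow_of_abs_le {c : ℕ → ℝ} {C z : ℝ} {k : ℕ}
    (hc : ∀ n, |c n| ≤ C * ((n : ℝ) + 1) ^ k) (hz : |z| < 1) :
    Summable fun n => c n * z ^ n := by
  have hz' : ‖|z|‖ < 1 := by simpa using hz
  have h : Summable fun n : ℕ => C * 2 ^ k * ((n : ℝ) ^ k * |z| ^ n) :=
    (summable_pow_mul_geometric_of_norm_lt_one (R := ℝ) k hz').mul_left (C * 2 ^ k)
  refine Summable.of_norm_bounded_eventually_nat h ?_
  filter_upwards [eventually_ge_atTop 1] with n hn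
  have hC : 0 ≤ C := by simpa using (abs_nonneg _).trans (hc 0)
  have hn' : (1 : ℝ) ≤ n := by exact_mod_cast hn
  calc ‖c n * z ^ n‖ = |c n| * |z| ^ n := by simp
    _ ≤ C * ((n : ℝ) + 1) ^ k * |z| ^ n := by gcongr; exact hc n
    _ ≤ C * (2 * (n : ℝ)) ^ k * |z| ^ n := by gcongr; linarith
    _ = C * 2 ^ k * ((n : ℝ) ^ k * |z| ^ n) := by ring

lemma abs_succ_mul_succ_le {c : ℕ → ℝ} {C : ℝ} {k : ℕ}
    (hc : ∀ n, |c n| ≤ C * ((n : ℝ) + 1) ^ k) (n : ℕ) :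
    |((n : ℝ) + 1) * c (n + 1)| ≤ C * 2 ^ k * ((n : ℝ) + 1) ^ (k + 1) := by
  have hC : 0 ≤ C := by simpa using (abs_nonneg _).trans (hc 0)
  have h := hc (n + 1)
  push_cast at h
  rw [abs_mul, abs_of_nonneg (by positivity : (0 : ℝ) ≤ n + 1)]
  calc ((n : ℝ) + 1) * |c (n + 1)| ≤ (n + 1) * (C * (2 * ((n : ℝ) + 1)) ^ k) := by
        gcongr
        refine h.trans ?_
        gcongr
        linarith
    _ = C * 2 ^ k * ((n : ℝ) + 1) ^ (k + 1) := by rw [mul_pow]; ring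

lemma hasDerivAt_tsum_mul_pow {c : ℕ → ℝ} {C z : ℝ} {k : ℕ}
    (hc : ∀ n, |c n| ≤ C * ((n : ℝ) + 1) ^ k) (hz : |z| < 1) :
    HasDerivAt (fun y => ∑' n, c n * y ^ n) (∑' n : ℕ, (((n : ℝ) + 1) * c (n + 1)) * z ^ n) z := by
  obtain ⟨r, hzr, hr⟩ := exists_between hz
  have hr0 : 0 ≤ r := (abs_nonneg z).trans hzr.le
  have hd := abs_succ_mul_succ_le hc
  have hu : Summable fun n : ℕ => |c n * (n * r ^ (n - 1))| := by
    rw [← summable_nat_add_iff 1]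
    refine (summable_mul_pow_of_abs_le (c := fun n : ℕ => |((n : ℝ) + 1) * c (n + 1)|)
      (z := r) (by simpa only [abs_abs] using hd) (by rwa [abs_of_nonneg hr0])).congr fun n => ?_
    simp only [abs_mul, abs_pow, Nat.cast_add, Nat.cast_one, Nat.add_sub_cancel, abs_of_nonneg hr0]
    ring
  have h := hasDerivAt_tsum_of_isPreconnected (t := Metric.ball (0 : ℝ) r)
    (g := fun n y => c n * y ^ n) (g' := fun n y => c n * (n * y ^ (n - 1))) (y₀ := 0) (y := z) hu
    Metric.isOpen_ball (convex_ball _ _).isPreconnected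
    (fun n y _ => (hasDerivAt_pow n y).const_mul (c n))
    (fun n y hy => by
      have hy : |y| < r := by simpa using hy
      simp only [Real.norm_eq_abs, abs_mul, abs_pow, abs_of_nonneg hr0]
      gcongr)
    (by simpa using (abs_nonneg z).trans_lt hzr)
    (summable_mul_pow_of_abs_le hc (by simp)) (by simpa using hzr)
  refine h.congr_deriv ?_
  have hs : Summable fun n : ℕ => c n * (n * z ^ (n - 1)) := by
    rw [← summable_nat_add_iff 1]
    refine (summable_mul_pow_of_abs_le hd hz).congr fun n => ?_
    simp only [Nat.cast_add, Nat.cast_one, Nat.add_sub_cancel]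
    ring
  rw [hs.tsum_eq_zero_add]
  simp only [Nat.cast_add, Nat.cast_one, Nat.add_sub_cancel, Nat.cast_zero, zero_mul, mul_zero,
    zero_add]
  exact tsum_congr fun n => by ring

lemma hasSum_mul_pow_succ {f u : ℕ → ℝ} {A z : ℝ} (h : HasSum (fun n => f n * z ^ n) A)
    (h0 : u 0 = 0) (hu : ∀ n, u (n + 1) = f n) : HasSum (fun n => u n * z ^ n) (z * A) := by
  rw [← hasSum_nat_add_iff' 1]
  simp only [Finset.sum_range_one, h0, zero_mul, sub_zero, hu]
  exact (h.mul_left z).congr_fun fun n => by ring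

/-- The coefficients of `₂F₁(a,b;1;z)`. -/
noncomputable def gaussCoeff (a b : ℝ) (n : ℕ) : ℝ :=
  ((ascPochhammer ℝ n).eval a * (ascPochhammer ℝ n).eval b) /
    ((ascPochhammer ℝ n).eval 1 * (n.factorial : ℝ))

lemma hyp2F1_one_eq_tsum (a b : ℝ) :
    hyp2F1 a b 1 = fun z => ∑' n, gaussCoeff a b n * z ^ n := rfl

lemma gaussCoeff_zero (a b : ℝ) : gaussCoeff a b 0 = 1 := by simp [gaussCoeff]

lemma gaussCoeff_succ (a b : ℝ) (n : ℕ) :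
    gaussCoeff a b (n + 1) = (a + n) * (b + n) / ((n : ℝ) + 1) ^ 2 * gaussCoeff a b n := by
  have h : (n : ℝ) + 1 ≠ 0 := by positivity
  have h' : (n.factorial : ℝ) ≠ 0 := by positivity
  simp only [gaussCoeff, ascPochhammer_succ_eval, ascPochhammer_eval_one, Nat.factorial_succ,
    Nat.cast_mul, Nat.cast_add, Nat.cast_one]
  field_simp
  ring

section

variable {a b : ℝ}

lemma abs_gaussCoeff_le_one (ha : a ∈ Set.Icc 0 1) (hb : b ∈ Set.Icc 0 1) (n : ℕ) :
    |gaussCoeff a b n| ≤ 1 := by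
  induction n with
  | zero => simp [gaussCoeff_zero]
  | succ n ih =>
    obtain ⟨ha0, ha1⟩ := ha
    obtain ⟨hb0, hb1⟩ := hb
    rw [gaussCoeff_succ, abs_mul, abs_of_nonneg (by positivity)]
    refine mul_le_one₀ ?_ (abs_nonneg _) ih
    rw [div_le_one (by positivity), sq]
    exact mul_le_mul (by linarith) (by linarith) (by positivity) (by positivity)

/-- `₂F₁(a,b;1;z)` satisfies Gauss's equation on the unit interval, with explicit derivatives. -/
lemma exists_hasDerivAt_hyp2F1_one (ha : a ∈ Set.Icc 0 1) (hb : b ∈ Set.Icc 0 1) :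
    ∃ F₁ F₂ : ℝ → ℝ, ∀ z, |z| < 1 →
      HasDerivAt (hyp2F1 a b 1) (F₁ z) z ∧ HasDerivAt F₁ (F₂ z) z ∧
      z * (1 - z) * F₂ z + (1 - (a + b + 1) * z) * F₁ z - a * b * hyp2F1 a b 1 z = 0 := by
  have hc : ∀ n : ℕ, |gaussCoeff a b n| ≤ 1 * ((n : ℝ) + 1) ^ 0 := fun n => by
    simpa using abs_gaussCoeff_le_one ha hb n
  have hd := abs_succ_mul_succ_le hc
  have he := abs_succ_mul_succ_le (c := fun n : ℕ => ((n : ℝ) + 1) * gaussCoeff a b (n + 1)) hd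
  refine ⟨fun z => ∑' n : ℕ, (((n : ℝ) + 1) * gaussCoeff a b (n + 1)) * z ^ n,
    fun z => ∑' n : ℕ, (((n : ℝ) + 1) * (((n + 1 : ℕ) + 1) * gaussCoeff a b (n + 1 + 1))) * z ^ n,
    fun z hz => ⟨hasDerivAt_tsum_mul_pow hc hz, hasDerivAt_tsum_mul_pow hd hz, ?_⟩⟩
  have h₀ := (summable_mul_pow_of_abs_le hc hz).hasSum
  have h₁ := (summable_mul_pow_of_abs_le hd hz).hasSum
  have h₂ := (summable_mul_pow_of_abs_le he hz).hasSum
  have hz₁ := hasSum_mul_pow_succ (u := fun n : ℕ => (n : ℝ) * gaussCoeff a b n) h₁ (by simp)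
    fun n => by push_cast; ring
  have hz₂ := hasSum_mul_pow_succ
    (u := fun n : ℕ => (n : ℝ) * ((n : ℝ) + 1) * gaussCoeff a b (n + 1)) h₂ (by simp)
    fun n => by push_cast; ring
  have hzz₂ := hasSum_mul_pow_succ
    (u := fun n : ℕ => ((n : ℝ) - 1) * n * gaussCoeff a b n) hz₂ (by simp)
    fun n => by push_cast; ring
  have key := (((hz₂.sub hzz₂).add h₁).sub (hz₁.mul_left (a + b + 1))).sub (h₀.mul_left (a * b))
  have hzero := key.unique (hasSum_zero.congr_fun fun n => by
    have hn : (n : ℝ) + 1 ≠ 0 := by positivity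
    rw [gaussCoeff_succ]
    field_simp
    ring)
  rw [hyp2F1_one_eq_tsum]
  linear_combination hzero

end

lemma hyp2F1_zero (a b c : ℝ) : hyp2F1 a b c 0 = 1 := by
  rw [hyp2F1, tsum_eq_single 0 fun n hn => by simp [hn]]
  simp

lemma hasDerivAt_zFun {x : ℝ} (hx : 1 - 3 * x ≠ 0) :
    HasDerivAt zFun (54 * x / (1 - 3 * x) ^ 4) x := by
  have hl : HasDerivAt (fun y : ℝ => 1 - 3 * y) (-3) x := by
    simpa using ((hasDerivAt_id x).const_mul 3).const_sub 1
  have hn : HasDerivAt (fun y : ℝ => 27 * y ^ 2 * (1 - y)) (54 * x - 81 * x ^ 2) x := by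
    refine (((hasDerivAt_pow 2 x).const_mul 27).fun_mul
      ((hasDerivAt_id' x).const_sub 1)).congr_deriv ?_
    push_cast
    ring
  refine (hn.fun_div (hl.fun_pow 3) (pow_ne_zero 3 hx)).congr_deriv ?_
  have hx' : 1 - x * 3 ≠ 0 := by rwa [mul_comm x]
  push_cast
  field_simp
  ring

lemma hasDerivAt_inv_one_sub_three_mul {x : ℝ} (hx : 1 - 3 * x ≠ 0) :
    HasDerivAt (fun y : ℝ => (1 - 3 * y)⁻¹) (3 * (1 - 3 * x)⁻¹ ^ 2) x := by
  have hl : HasDerivAt (fun y : ℝ => 1 - 3 * y) (-3) x := by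
    simpa using ((hasDerivAt_id x).const_mul 3).const_sub 1
  refine (hl.fun_inv hx).congr_deriv ?_
  field_simp

lemma zFun_mem_Ioo {x : ℝ} (hx : x ∈ Set.Ioo (0 : ℝ) (1 / 9)) : 0 < zFun x ∧ zFun x < 1 := by
  obtain ⟨h0, h1⟩ := hx
  have h3 : 0 < 1 - 3 * x := by linarith
  have h4 : 0 < 1 - x := by linarith
  unfold zFun
  refine ⟨by positivity, ?_⟩
  rw [div_lt_one (by positivity)]
  nlinarith

lemma hasDerivAt_hFun {F₁ : ℝ → ℝ} {x : ℝ} (hx : 1 - 3 * x ≠ 0)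
    (hF : HasDerivAt (hyp2F1 (1 / 3) (2 / 3) 1) (F₁ (zFun x)) (zFun x)) :
    HasDerivAt hFun (3 * (1 - 3 * x)⁻¹ ^ 2 * hyp2F1 (1 / 3) (2 / 3) 1 (zFun x) +
      54 * x * (1 - 3 * x)⁻¹ ^ 5 * F₁ (zFun x)) x := by
  refine ((hasDerivAt_inv_one_sub_three_mul hx).fun_mul
    (hF.comp x (hasDerivAt_zFun hx))).congr_deriv ?_
  simp only [Function.comp_apply]
  field_simp

/-- for `x ∈ (0,1/9)` one has `0 < z(x) < 1` and `h` satisfies the Heun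
equation `x(1−x)(1−9x) h'' + (1−20x+27x²) h' + (9x−3) h = 0`; moreover `h` is continuous
at `0` with `h(0) = 1` and `h'(0) = 3`. -/
theorem stmt_18 :
    (∀ x ∈ Set.Ioo (0 : ℝ) (1 / 9),
        (0 < zFun x ∧ zFun x < 1) ∧
          x * (1 - x) * (1 - 9 * x) * deriv (deriv hFun) x +
            (1 - 20 * x + 27 * x ^ 2) * deriv hFun x + (9 * x - 3) * hFun x = 0) ∧
      ContinuousAt hFun 0 ∧ hFun 0 = 1 ∧ deriv hFun 0 = 3 := by
  obtain ⟨F₁, F₂, hF⟩ := exists_hasDerivAt_hyp2F1_one (a := 1 / 3) (b := 2 / 3)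
    (by norm_num) (by norm_num)
  have hz0 : zFun 0 = 0 := by simp [zFun]
  have h0 : HasDerivAt hFun 3 0 := by
    refine (hasDerivAt_hFun (by norm_num) (hF (zFun 0) (by simp [hz0])).1).congr_deriv ?_
    simp [hz0, hyp2F1_zero]
  refine ⟨fun x hx => ⟨zFun_mem_Ioo hx, ?_⟩, h0.continuousAt, by simp [hFun, hz0, hyp2F1_zero],
    h0.deriv⟩
  have hne : ∀ y ∈ Set.Ioo (0 : ℝ) (1 / 9), 1 - 3 * y ≠ 0 := fun y hy =>
    ne_of_gt (by linarith [hy.2])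
  have hF' : ∀ y ∈ Set.Ioo (0 : ℝ) (1 / 9), _ := fun y hy =>
    hF (zFun y) (abs_lt.2 ⟨by linarith [(zFun_mem_Ioo hy).1], (zFun_mem_Ioo hy).2⟩)
  have hx3 := hne x hx
  obtain ⟨hd₁, hd₂, hode⟩ := hF' x hx
  have hderiv : deriv hFun =ᶠ[𝓝 x] fun y =>
      3 * (1 - 3 * y)⁻¹ ^ 2 * hyp2F1 (1 / 3) (2 / 3) 1 (zFun y) +
        54 * y * (1 - 3 * y)⁻¹ ^ 5 * F₁ (zFun y) := by
    filter_upwards [isOpen_Ioo.mem_nhds hx] with y hy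
    exact (hasDerivAt_hFun (hne y hy) (hF' y hy).1).deriv
  have hu := hasDerivAt_inv_one_sub_three_mul hx3
  have hz := hasDerivAt_zFun hx3
  have hderiv₂ := (((hu.fun_pow 2).const_mul 3).fun_mul (hd₁.comp x hz)).fun_add
    ((((hasDerivAt_id' x).const_mul 54).fun_mul (hu.fun_pow 5)).fun_mul (hd₂.comp x hz))
  simp only [Function.comp_apply] at hderiv₂
  rw [hderiv.deriv_eq, hderiv.eq_of_nhds, hderiv₂.deriv, hFun]
  generalize hyp2F1 (1 / 3) (2 / 3) 1 (zFun x) = f₀ at hode ⊢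
  generalize F₁ (zFun x) = f₁ at hode ⊢
  generalize F₂ (zFun x) = f₂ at hode ⊢
  rw [zFun] at hode
  rw [← mul_zero (108 * x / (1 - 3 * x) ^ 3), ← hode]
  have hx3' : 1 - x * 3 ≠ 0 := by rwa [mul_comm x]
  push_cast
  field_simp
  ring
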